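/- arXiv:0704.2817 — 2 statements merged into one kernel-verified Lean document; each statement's English description precedes it below -/
import Mathlib

section
/- In U_q^-(gl_∞) the following commutation relations hold for odd integers i, j, k, ℓ: (1) ⟨i,j⟩⟨k,ℓ⟩ = ⟨k,ℓ⟩⟨i,j⟩ for i ≤ j, k ≤ ℓ and j < k−2; (2) ⟨i,j⟩⟨j+2,k⟩ = ⟨i,k⟩ + q⟨j+2,k⟩⟨i,j⟩ for i ≤ j < k; (3) ⟨j,k⟩⟨i,ℓ⟩ = ⟨i,ℓ⟩⟨j,k⟩ for i < j ≤ k < ℓ; (4) ⟨i,k⟩⟨j,k⟩ = q^{−1}⟨j,k⟩⟨i,k⟩ for i < j ≤ k; (5) ⟨i,j⟩⟨i,k⟩ = q^{−1}⟨i,k⟩⟨i,j⟩ for i ≤ j < k; (6) ⟨i,k⟩⟨j,ℓ⟩ = ⟨j,ℓ⟩⟨i,k⟩ + (q^{−1} − q)⟨i,ℓ⟩⟨j,k⟩ for i < j ≤ k < ℓ. -/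
/-! Basic setup: `K = ℚ(q)` and the algebra `U_q^-(gl_∞)`. -/

noncomputable section

/-- The base field `K = ℚ(q)`. -/
abbrev K : Type := RatFunc ℚ

/-- The indeterminate `q`. -/
def q : K := RatFunc.X

/-- The `q`-integer `[n]`. -/
def qint (n : ℤ) : K := (q ^ n - q ^ (-n)) / (q - q⁻¹)

/-- The `q`-factorial `[n]!`. -/
def qfact (n : ℕ) : K := ∏ k ∈ Finset.range n, qint (k + 1)

/-- The `q`-Serre relations defining `U_q^-(gl_∞)`; the generator indexed by `a : ℤ`
corresponds to `f_i` for the odd integer `i = 2a+1`, so that `|i - j| > 2 ↔ 1 < |a - b|`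
and `|i - j| = 2 ↔ |a - b| = 1`. -/
inductive URel : FreeAlgebra K ℤ → FreeAlgebra K ℤ → Prop
  | far (a b : ℤ) (h : 1 < |a - b|) :
      URel (FreeAlgebra.ι K a * FreeAlgebra.ι K b) (FreeAlgebra.ι K b * FreeAlgebra.ι K a)
  | serre (a b : ℤ) (h : |a - b| = 1) :
      URel (FreeAlgebra.ι K a * FreeAlgebra.ι K a * FreeAlgebra.ι K b
            + FreeAlgebra.ι K b * (FreeAlgebra.ι K a * FreeAlgebra.ι K a))
           ((q + q⁻¹) • (FreeAlgebra.ι K a * FreeAlgebra.ι K b * FreeAlgebra.ι K a))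

/-- The algebra `U_q^-(gl_∞)`. -/
abbrev U : Type := RingQuot URel

/-- The generator `f_i` of `U_q^-(gl_∞)`, for an odd integer `i`. -/
def fgen (i : ℤ) : U := RingQuot.mkAlgHom K URel (FreeAlgebra.ι K ((i - 1) / 2))

/-- `segAux i n` is the segment `⟨i, i+2n⟩`. -/
def segAux (i : ℤ) : ℕ → U
  | 0 => fgen i
  | n + 1 => segAux i n * fgen (i + 2 * (n + 1)) - q • (fgen (i + 2 * (n + 1)) * segAux i n)

/-- The segment `⟨i,j⟩ ∈ U_q^-(gl_∞)` for odd `i ≤ j`. -/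
def seg (i j : ℤ) : U := segAux i ((j - i) / 2).toNat

/-- The divided power `⟨i,j⟩^{(n)}` (zero for `n < 0`). -/
def segPow (i j : ℤ) (n : ℤ) : U :=
  if n < 0 then 0 else (qfact n.toNat)⁻¹ • seg i j ^ n.toNat

/-- The modified divided power `⟨i,j⟩^{[n]}`. -/
def segPowM (i j : ℤ) (n : ℤ) : U :=
  if i = -j then
    (if n < 0 then 0 else (∏ ν ∈ Finset.range n.toNat, qint (2 * (ν + 1)))⁻¹ • seg i j ^ n.toNat)
  else segPow i j n


section QCommutator

variable {k A : Type*} [Field k] [Ring A] [Algebra k A] {t : k}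

/-- A `t`-commutator of elements commuting with `b` up to scalars `r` and `s`
commutes with `b` up to the scalar `r * s`. -/
lemma smul_qbracket_mul {x y b : A} {r s : k} (hx : r • (x * b) = b * x)
    (hy : s • (y * b) = b * y) :
    (r * s) • ((x * y - t • (y * x)) * b) = b * (x * y - t • (y * x)) := by
  have e1 := congrArg (x * ·) hy
  have e2 := congrArg (· * y) hx
  have e3 := congrArg (y * ·) hx
  have e4 := congrArg (· * x) hy
  simp only [mul_sub, sub_mul, smul_mul_assoc, mul_smul_comm, mul_assoc] at *
  linear_combination (norm := module) r • e1 + e2 - (s * t) • e3 - t • e4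

lemma qbracket_assoc {x y z : A} (h : x * z = z * x) :
    (x * y - t • (y * x)) * z - t • (z * (x * y - t • (y * x))) =
      x * (y * z - t • (z * y)) - t • ((y * z - t • (z * y)) * x) := by
  have e1 := congrArg (y * ·) h
  have e2 := congrArg (· * y) h
  simp only [mul_sub, sub_mul, smul_mul_assoc, mul_smul_comm, mul_assoc] at *
  linear_combination (norm := module) -t • e1 + t • e2

lemma smul_qbracket_mul_of_serre_right {x y : A} (ht : t ≠ 0)
    (h : y * y * x + x * (y * y) = (t + t⁻¹) • (y * x * y)) :
    t • ((x * y - t • (y * x)) * y) = y * (x * y - t • (y * x)) := by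
  have h1 : t * (t + t⁻¹) = t ^ 2 + 1 := by rw [mul_add, mul_inv_cancel₀ ht]; ring
  have h2 := congrArg (t • ·) h
  simp only [smul_smul, h1] at h2
  simp only [mul_sub, sub_mul, smul_mul_assoc, mul_smul_comm, mul_assoc] at *
  linear_combination (norm := module) h2

lemma smul_mul_qbracket_of_serre_left {x y : A} (ht : t ≠ 0)
    (h : x * x * y + y * (x * x) = (t + t⁻¹) • (x * y * x)) :
    t • (x * (x * y - t • (y * x))) = (x * y - t • (y * x)) * x := by
  have h1 : t * (t + t⁻¹) = t ^ 2 + 1 := by rw [mul_add, mul_inv_cancel₀ ht]; ring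
  have h2 := congrArg (t • ·) h
  simp only [smul_smul, h1] at h2
  simp only [mul_sub, sub_mul, smul_mul_assoc, mul_smul_comm, mul_assoc] at *
  linear_combination (norm := module) h2

lemma qbracket_triple_mul {x y z e f g : A} (hxz : x * z = z * x) (he : e = x * y - t • (y * x))
    (hf : f = y * z - t • (z * y)) (hg : g = e * z - t • (z * e))
    (hyf : t • (y * f) = f * y) :
    g * y = t • (e * f - f * e) + t ^ 2 • (y * g) := by
  have hg' : g = x * f - t • (f * x) := by rw [hg, he, hf, qbracket_assoc hxz]
  have e1 := congrArg (x * ·) hyf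
  have e2 := congrArg (· * x) hyf
  rw [hg', he]
  simp only [mul_sub, sub_mul, smul_mul_assoc, mul_smul_comm, mul_assoc] at *
  linear_combination (norm := module) -e1 + t ^ 2 • e2

lemma sq_smul_qbracket_triple_mul {y z e f g : A} (hf : f = y * z - t • (z * y))
    (hg : g = e * z - t • (z * e))
    (hey : t • (e * y) = y * e) :
    t ^ 2 • (g * y) = y * g - t • (e * f - f * e) := by
  have e1 := congrArg (· * z) hey
  have e2 := congrArg (z * ·) hey
  rw [hg, hf]
  simp only [mul_sub, sub_mul, smul_mul_assoc, mul_smul_comm, mul_assoc] at *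
  linear_combination (norm := module) e1 - t ^ 2 • e2

/-- In the triple `t`-commutator of `x, y, z`, the middle element `y` commutes with the whole. -/
lemma qbracket_triple_comm {x y z e f g : A} (hxz : x * z = z * x) (he : e = x * y - t • (y * x))
    (hf : f = y * z - t • (z * y)) (hg : g = e * z - t • (z * e))
    (hey : t • (e * y) = y * e) (hyf : t • (y * f) = f * y) (ht2 : 1 + t ^ 2 ≠ 0) :
    g * y = y * g := by
  have e1 := qbracket_triple_mul hxz he hf hg hyf
  have e2 := sq_smul_qbracket_triple_mul hf hg hey
  have e3 : (1 + t ^ 2) • (g * y) = (1 + t ^ 2) • (y * g) := by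
    linear_combination (norm := module) e1 + e2
  exact smul_right_injective A ht2 e3

lemma qbracket_triple_commutator {x y z e f g : A} (hxz : x * z = z * x)
    (he : e = x * y - t • (y * x))
    (hf : f = y * z - t • (z * y)) (hg : g = e * z - t • (z * e))
    (hey : t • (e * y) = y * e) (hyf : t • (y * f) = f * y)
    (ht : t ≠ 0) (ht2 : 1 + t ^ 2 ≠ 0) :
    e * f = f * e + (t⁻¹ - t) • (g * y) := by
  have e1 := qbracket_triple_mul hxz he hf hg hyf
  rw [← qbracket_triple_comm hxz he hf hg hey hyf ht2] at e1
  have e2 : t • (e * f) = t • (f * e + (t⁻¹ - t) • (g * y)) := by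
    have h1 : t * (t⁻¹ - t) = 1 - t ^ 2 := by
      rw [mul_sub, mul_inv_cancel₀ ht]; ring
    rw [smul_add, smul_smul, h1]
    linear_combination (norm := module) -e1
  exact smul_right_injective A ht e2

end QCommutator

lemma q_ne_zero : q ≠ 0 := RatFunc.X_ne_zero

lemma one_add_q_sq_ne_zero : 1 + q ^ 2 ≠ 0 := by
  have h : (1 + q ^ 2 : K) = algebraMap (Polynomial ℚ) K (1 + Polynomial.X ^ 2) := by
    simp [q]
  rw [h]
  refine RatFunc.algebraMap_ne_zero fun h0 => ?_
  have := congrArg (Polynomial.eval 0) h0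
  simp at this

/-- The segment `⟨2a+1, 2b+1⟩`. -/
def oddSeg (a b : ℤ) : U := seg (2 * a + 1) (2 * b + 1)

lemma oddSeg_self (a : ℤ) : oddSeg a a = RingQuot.mkAlgHom K URel (FreeAlgebra.ι K a) := by
  simp [oddSeg, seg, segAux, fgen]

lemma oddSeg_succ {a b : ℤ} (h : a ≤ b) :
    oddSeg a (b + 1) =
      oddSeg a b * oddSeg (b + 1) (b + 1) - q • (oddSeg (b + 1) (b + 1) * oddSeg a b) := by
  obtain ⟨n, rfl⟩ := Int.le.dest h
  have h1 : ((2 * (a + n + 1) + 1 - (2 * a + 1)) / 2).toNat = n + 1 := by omega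
  have h2 : ((2 * (a + n) + 1 - (2 * a + 1)) / 2).toNat = n := by omega
  have h3 : 2 * a + 1 + 2 * ((n : ℤ) + 1) = 2 * (a + n + 1) + 1 := by ring
  simp only [oddSeg, seg, h1, h2, segAux, h3, sub_self, Int.zero_ediv, Int.toNat_zero]

lemma oddSeg_self_far {a b : ℤ} (h : a + 1 < b) :
    oddSeg a a * oddSeg b b = oddSeg b b * oddSeg a a := by
  simp only [oddSeg_self, ← map_mul]
  exact RingQuot.mkAlgHom_rel K (URel.far a b (by rw [abs_sub_comm, abs_of_pos] <;> omega))

lemma oddSeg_serre {a b : ℤ} (h : |a - b| = 1) :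
    oddSeg a a * oddSeg a a * oddSeg b b + oddSeg b b * (oddSeg a a * oddSeg a a) =
      (q + q⁻¹) • (oddSeg a a * oddSeg b b * oddSeg a a) := by
  simp only [oddSeg_self, ← map_mul, ← map_add, ← map_smul]
  exact RingQuot.mkAlgHom_rel K (URel.serre a b h)

lemma oddSeg_comm_self {a b c : ℤ} (hab : a ≤ b) (hbc : b + 1 < c) :
    oddSeg a b * oddSeg c c = oddSeg c c * oddSeg a b := by
  induction b, hab using Int.leInduction with
  | base => exact oddSeg_self_far hbc
  | succ b hab ih =>
    have := smul_qbracket_mul (t := q) (r := 1) (s := 1) (x := oddSeg a b) (b := oddSeg c c)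
      (by rw [one_smul, ih (by omega)]) (by rw [one_smul, oddSeg_self_far hbc])
    rwa [← oddSeg_succ hab, mul_one, one_smul] at this

lemma oddSeg_comm {a b c d : ℤ} (hab : a ≤ b) (hcd : c ≤ d) (hbc : b + 1 < c) :
    oddSeg a b * oddSeg c d = oddSeg c d * oddSeg a b := by
  induction d, hcd using Int.leInduction with
  | base => exact oddSeg_comm_self hab hbc
  | succ d hcd ih =>
    have := smul_qbracket_mul (t := q) (r := 1) (s := 1) (x := oddSeg c d)
      (y := oddSeg (d + 1) (d + 1)) (b := oddSeg a b)
      (by rw [one_smul, ih]) (by rw [one_smul, oddSeg_comm_self hab (by omega)])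
    rw [← oddSeg_succ hcd, mul_one, one_smul] at this
    exact this.symm

lemma oddSeg_split {a b c : ℤ} (hab : a ≤ b) (hbc : b + 1 ≤ c) :
    oddSeg a c = oddSeg a b * oddSeg (b + 1) c - q • (oddSeg (b + 1) c * oddSeg a b) := by
  induction c, hbc using Int.leInduction with
  | base => exact oddSeg_succ hab
  | succ c hbc ih =>
    rw [oddSeg_succ (by omega : a ≤ c), ih,
      qbracket_assoc (oddSeg_comm_self hab (by omega)), ← oddSeg_succ hbc]

lemma oddSeg_split_pred {a b c : ℤ} (hab : a < b) (hbc : b ≤ c) :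
    oddSeg a c = oddSeg a (b - 1) * oddSeg b c - q • (oddSeg b c * oddSeg a (b - 1)) := by
  have := oddSeg_split (a := a) (b := b - 1) (c := c) (by omega) (by omega)
  rwa [sub_add_cancel] at this

lemma oddSeg_right_of_adjacent {b c : ℤ} (hbc : b ≤ c)
    (h : q • (oddSeg (b - 1) c * oddSeg b c) = oddSeg b c * oddSeg (b - 1) c)
    {a : ℤ} (hab : a < b) :
    q • (oddSeg a c * oddSeg b c) = oddSeg b c * oddSeg a c := by
  rcases eq_or_ne a (b - 1) with rfl | hne
  · exact h
  · have := smul_qbracket_mul (t := q) (r := 1) (s := q) (x := oddSeg a (b - 1 - 1))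
      (by rw [one_smul, oddSeg_comm (by omega) hbc (by omega)]) h
    rwa [← oddSeg_split_pred (by omega) (by omega), one_mul] at this

lemma oddSeg_left_of_adjacent {a b : ℤ} (hab : a ≤ b)
    (h : q • (oddSeg a b * oddSeg a (b + 1)) = oddSeg a (b + 1) * oddSeg a b)
    {c : ℤ} (hbc : b < c) :
    q • (oddSeg a b * oddSeg a c) = oddSeg a c * oddSeg a b := by
  rcases eq_or_ne c (b + 1) with rfl | hne
  · exact h
  · have h' : q⁻¹ • (oddSeg a (b + 1) * oddSeg a b) = oddSeg a b * oddSeg a (b + 1) := by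
      rw [← h, inv_smul_smul₀ q_ne_zero]
    have := smul_qbracket_mul (t := q) (r := q⁻¹) (s := 1) (y := oddSeg (b + 1 + 1) c) h'
      (by rw [one_smul, oddSeg_comm hab (by omega) (by omega)])
    rw [← oddSeg_split (by omega) (by omega), mul_one] at this
    rw [← this, smul_inv_smul₀ q_ne_zero]

lemma oddSeg_self_adjacent_right (b : ℤ) :
    q • (oddSeg (b - 1) b * oddSeg b b) = oddSeg b b * oddSeg (b - 1) b := by
  rw [oddSeg_split_pred (by omega : b - 1 < b) le_rfl]
  exact smul_qbracket_mul_of_serre_right q_ne_zero (oddSeg_serre (by simp))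

lemma oddSeg_self_adjacent_left (b : ℤ) :
    q • (oddSeg b b * oddSeg b (b + 1)) = oddSeg b (b + 1) * oddSeg b b := by
  rw [oddSeg_split le_rfl le_rfl]
  exact smul_mul_qbracket_of_serre_left q_ne_zero (oddSeg_serre (by simp))

lemma oddSeg_comm_inner_of_adjacent {b c : ℤ} (hbc : b ≤ c)
    (hr : q • (oddSeg (b - 1) c * oddSeg b c) = oddSeg b c * oddSeg (b - 1) c)
    (hl : q • (oddSeg b c * oddSeg b (c + 1)) = oddSeg b (c + 1) * oddSeg b c) :
    oddSeg (b - 1) (c + 1) * oddSeg b c = oddSeg b c * oddSeg (b - 1) (c + 1) :=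
  qbracket_triple_comm (oddSeg_comm (by omega) le_rfl (by omega))
    (oddSeg_split_pred (by omega) hbc) (oddSeg_succ hbc) (oddSeg_succ (by omega)) hr hl
    one_add_q_sq_ne_zero

lemma oddSeg_adjacent (n : ℕ) : ∀ b c : ℤ, c = b + n →
    q • (oddSeg (b - 1) c * oddSeg b c) = oddSeg b c * oddSeg (b - 1) c ∧
    q • (oddSeg b c * oddSeg b (c + 1)) = oddSeg b (c + 1) * oddSeg b c := by
  induction n with
  | zero =>
    rintro b c rfl
    simpa using ⟨oddSeg_self_adjacent_right b, oddSeg_self_adjacent_left b⟩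
  | succ n ih =>
    intro b c hc
    push_cast at hc
    constructor
    · obtain ⟨d, rfl⟩ : ∃ d, c = d + 1 := ⟨c - 1, by ring⟩
      obtain ⟨hr, hl⟩ := ih b d (by omega)
      have hD := oddSeg_comm_inner_of_adjacent (by omega) hr hl
      have hf := oddSeg_right_of_adjacent le_rfl (oddSeg_self_adjacent_right (d + 1))
        (a := b - 1) (by omega)
      have hf' : q⁻¹ • (oddSeg (d + 1) (d + 1) * oddSeg (b - 1) (d + 1)) =
          oddSeg (b - 1) (d + 1) * oddSeg (d + 1) (d + 1) := by
        rw [← hf, inv_smul_smul₀ q_ne_zero]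
      have := smul_qbracket_mul (t := q) (r := 1) (s := q⁻¹) (x := oddSeg b d)
        (by rw [one_smul, hD]) hf'
      rw [← oddSeg_succ (by omega), one_mul] at this
      rw [← this, smul_inv_smul₀ q_ne_zero]
    · obtain ⟨a, rfl⟩ : ∃ a, b = a - 1 := ⟨b + 1, by ring⟩
      obtain ⟨hr, hl⟩ := ih a c (by omega)
      have hD := oddSeg_comm_inner_of_adjacent (by omega) hr hl
      have hf := oddSeg_left_of_adjacent le_rfl (oddSeg_self_adjacent_left (a - 1))
        (c := c + 1) (by omega)
      have := smul_qbracket_mul (t := q) (r := q) (s := 1) (y := oddSeg a c) hf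
        (by rw [one_smul, hD])
      rwa [← oddSeg_split_pred (by omega) (by omega), mul_one] at this

lemma oddSeg_right {a b c : ℤ} (hab : a < b) (hbc : b ≤ c) :
    q • (oddSeg a c * oddSeg b c) = oddSeg b c * oddSeg a c :=
  oddSeg_right_of_adjacent hbc (oddSeg_adjacent (c - b).toNat b c (by omega)).1 hab

lemma oddSeg_left {a b c : ℤ} (hab : a ≤ b) (hbc : b < c) :
    q • (oddSeg a b * oddSeg a c) = oddSeg a c * oddSeg a b :=
  oddSeg_left_of_adjacent hab (oddSeg_adjacent (b - a).toNat a b (by omega)).2 hbc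

lemma oddSeg_comm_inner {a b c d : ℤ} (hab : a < b) (hbc : b ≤ c) (hcd : c < d) :
    oddSeg a d * oddSeg b c = oddSeg b c * oddSeg a d :=
  qbracket_triple_comm (oddSeg_comm (by omega) hcd (by omega))
    (oddSeg_split_pred hab hbc) (oddSeg_split hbc hcd) (oddSeg_split (by omega) hcd)
    (oddSeg_right hab hbc) (oddSeg_left hbc hcd) one_add_q_sq_ne_zero

lemma oddSeg_overlap {a b c d : ℤ} (hab : a < b) (hbc : b ≤ c) (hcd : c < d) :
    oddSeg a c * oddSeg b d =
      oddSeg b d * oddSeg a c + (q⁻¹ - q) • (oddSeg a d * oddSeg b c) :=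
  qbracket_triple_commutator (oddSeg_comm (by omega) hcd (by omega))
    (oddSeg_split_pred hab hbc) (oddSeg_split hbc hcd) (oddSeg_split (by omega) hcd)
    (oddSeg_right hab hbc) (oddSeg_left hbc hcd) q_ne_zero one_add_q_sq_ne_zero

/-- Proposition 3.14 of Enomoto–Kashiwara: commutation relations of the segments
`⟨i,j⟩` in `U_q^-(gl_∞)`. -/
theorem segment_commutation_relations :
    (∀ i j k l : ℤ, Odd i → Odd j → Odd k → Odd l →
      i ≤ j → k ≤ l → j < k - 2 → seg i j * seg k l = seg k l * seg i j) ∧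
    (∀ i j k : ℤ, Odd i → Odd j → Odd k →
      i ≤ j → j < k → seg i j * seg (j + 2) k = seg i k + q • (seg (j + 2) k * seg i j)) ∧
    (∀ i j k l : ℤ, Odd i → Odd j → Odd k → Odd l →
      i < j → j ≤ k → k < l → seg j k * seg i l = seg i l * seg j k) ∧
    (∀ i j k : ℤ, Odd i → Odd j → Odd k →
      i < j → j ≤ k → seg i k * seg j k = q⁻¹ • (seg j k * seg i k)) ∧
    (∀ i j k : ℤ, Odd i → Odd j → Odd k →
      i ≤ j → j < k → seg i j * seg i k = q⁻¹ • (seg i k * seg i j)) ∧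
    (∀ i j k l : ℤ, Odd i → Odd j → Odd k → Odd l →
      i < j → j ≤ k → k < l →
      seg i k * seg j l = seg j l * seg i k + (q⁻¹ - q) • (seg i l * seg j k)) := by
  refine ⟨?_, ?_, ?_, ?_, ?_, ?_⟩
  · rintro _ _ _ _ ⟨a, rfl⟩ ⟨b, rfl⟩ ⟨c, rfl⟩ ⟨d, rfl⟩ h1 h2 h3
    exact oddSeg_comm (by omega) (by omega) (by omega)
  · rintro _ _ _ ⟨a, rfl⟩ ⟨b, rfl⟩ ⟨c, rfl⟩ h1 h2
    have h := oddSeg_split (a := a) (b := b) (c := c) (by omega) (by omega)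
    have hb : 2 * b + 1 + 2 = 2 * (b + 1) + 1 := by ring
    rw [hb]
    exact (sub_eq_iff_eq_add.mp h.symm)
  · rintro _ _ _ _ ⟨a, rfl⟩ ⟨b, rfl⟩ ⟨c, rfl⟩ ⟨d, rfl⟩ h1 h2 h3
    exact (oddSeg_comm_inner (by omega) (by omega) (by omega)).symm
  · rintro _ _ _ ⟨a, rfl⟩ ⟨b, rfl⟩ ⟨c, rfl⟩ h1 h2
    exact (eq_inv_smul_iff₀ q_ne_zero).mpr (oddSeg_right (by omega) (by omega))
  · rintro _ _ _ ⟨a, rfl⟩ ⟨b, rfl⟩ ⟨c, rfl⟩ h1 h2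
    exact (eq_inv_smul_iff₀ q_ne_zero).mpr (oddSeg_left (by omega) (by omega))
  · rintro _ _ _ _ ⟨a, rfl⟩ ⟨b, rfl⟩ ⟨c, rfl⟩ ⟨d, rfl⟩ h1 h2 h3
    exact oddSeg_overlap (by omega) (by omega) (by omega)

end
end

section
/- In the module Ṽ_θ(0): (i) for odd integers 1 ≤ i ≤ j, ⟨−j,−i⟩φ̃ = ⟨i,j⟩φ̃; (ii) for odd integers 1 ≤ i < j, ⟨−j,i⟩φ̃ = q^{−1}⟨−i,j⟩φ̃. -/
/-! Basic setup: `K = ℚ(q)` and the algebra `U_q^-(gl_∞)`. -/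

noncomputable section

/-- The left ideal `Σ_k U_q^-(gl_∞)(f_k − f_{−k})` (over odd `k`). -/
def Jideal : Ideal U := Ideal.span {x : U | ∃ k : ℤ, Odd k ∧ x = fgen k - fgen (-k)}

/-- The quotient module `Ṽ_θ(0) = U_q^-(gl_∞)/Σ_k U_q^-(gl_∞)(f_k − f_{−k})`. -/
abbrev Vt : Type := U ⧸ Jideal

/-- The generator `φ̃ ∈ Ṽ_θ(0)`, image of `1`. -/
def phi : Vt := Submodule.Quotient.mk 1

section QuantumSerre

variable {F A : Type*} [Field F] [Ring A] [Algebra F A]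

/-- The `q`-Serre relation `x² y + y x² = (p + p⁻¹) x y x`. -/
def IsSerre (p : F) (x y : A) : Prop :=
  x * x * y + y * (x * x) = (p + p⁻¹) • (x * y * x)

/-- The `q`-commutator `x y - p y x`. -/
def qbr (p : F) (x y : A) : A := x * y - p • (y * x)

lemma qbr_inv {p : F} (hp : p ≠ 0) (x y : A) : qbr p x y = (-p) • qbr p⁻¹ y x := by
  simp only [qbr, smul_sub, smul_smul]
  rw [neg_mul, mul_inv_cancel₀ hp]
  module

lemma IsSerre.inv {p : F} {x y : A} (h : IsSerre p x y) : IsSerre p⁻¹ x y := by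
  unfold IsSerre at *
  rw [h, inv_inv, add_comm]

lemma IsSerre.smul_left {p : F} {x y : A} (h : IsSerre p x y) (c : F) :
    IsSerre p (c • x) y := by
  unfold IsSerre at *
  simp only [smul_mul_assoc, mul_smul_comm] at *
  rw [smul_comm (p + p⁻¹) c, smul_comm (p + p⁻¹) c, ← h]
  module

lemma IsSerre.smul_right {p : F} {x y : A} (h : IsSerre p x y) (c : F) :
    IsSerre p x (c • y) := by
  unfold IsSerre at *
  simp only [smul_mul_assoc, mul_smul_comm] at *
  rw [smul_comm (p + p⁻¹) c, ← h]
  module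

/-- If `x` commutes with `z`, the relation passes from `y` to the `q`-commutator of `y`, `z`. -/
lemma IsSerre.qbr_right {p : F} (r : F) {x y z : A} (h : IsSerre p x y) (hxz : Commute x z) :
    IsSerre p x (qbr r y z) := by
  unfold IsSerre qbr at *
  have h1 : z * x = x * z := hxz.eq.symm
  have h2 (w : A) : z * (x * w) = x * (z * w) := by rw [← mul_assoc, h1, mul_assoc]
  linear_combination (norm := skip) h * z - r • (z * h)
  simp only [mul_sub, sub_mul, mul_add, add_mul, smul_mul_assoc, mul_smul_comm, mul_assoc, h1, h2]
  module

/-- In type `A₃` with middle node `h`, the `q`-commutator `[h, d]` and `f` satisfy the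
`q`-Serre relation. -/
lemma IsSerre.qbr_left {p : F} (hp : p ≠ 0) (hs : p ^ 2 + 1 ≠ 0) {f h d : A}
    (hf : IsSerre p h f) (hd : IsSerre p h d) (dh : IsSerre p d h) (hdf : Commute d f) :
    IsSerre p (qbr p h d) f := by
  unfold IsSerre qbr at *
  have h1 : d * f = f * d := hdf.eq
  have h2 (w : A) : d * (f * w) = f * (d * w) := by rw [← mul_assoc, h1, mul_assoc]
  linear_combination (norm := skip) (p / (p ^ 2 + 1)) • (hf * d * d) - p • (d * hf * d)
    + (p ^ 3 / (p ^ 2 + 1)) • (d * d * hf)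
    + (p / (p ^ 2 + 1)) • (d * hd * f + d * f * hd - hd * d * f - f * hd * d)
    + p ^ 2 • (dh * f * h) - p • (f * dh * h) - p • (dh * h * f) + h * f * dh
  simp only [mul_sub, sub_mul, mul_add, add_mul, smul_mul_assoc, mul_smul_comm, mul_assoc, h1, h2]
  match_scalars <;> field_simp <;> ring

lemma Commute.qbr_right {p : F} {x y z : A} (hy : Commute x y) (hz : Commute x z) :
    Commute x (qbr p y z) :=
  (hy.mul_right hz).sub_right ((hz.mul_right hy).smul_right p)

lemma qbr_assoc (p : F) {x y z : A} (h : Commute x z) :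
    qbr p (qbr p x y) z = qbr p x (qbr p y z) := by
  have h1 : z * x = x * z := h.eq.symm
  have h2 (w : A) : z * (x * w) = x * (z * w) := by rw [← mul_assoc, h1, mul_assoc]
  simp only [qbr, mul_sub, sub_mul, smul_mul_assoc, mul_smul_comm, mul_assoc, h1, h2]
  module

lemma add_qcomm_eq {V : Type*} [AddCommGroup V] [Module F V] {p : F} (hp : p ≠ 0)
    {u u' v w w' z : V} (h : u + u' = p • v + p⁻¹ • v) (h' : w + w' = p • z + p⁻¹ • z) :
    w - p • u' + (w' - p • u) = (p + p⁻¹) • z - (p + p⁻¹) • p • v := by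
  linear_combination (norm := skip) h' - p • h
  match_scalars <;> field_simp <;> ring

lemma sub_smul_eq_of_add_eq {V : Type*} [AddCommGroup V] [Module F V] {p : F} (hp : p ≠ 0)
    {u v w : V} (h : u + v = (p + p⁻¹) • w) :
    v - p • w = p⁻¹ • w - u := by
  linear_combination (norm := skip) h
  match_scalars <;> field_simp <;> ring

end QuantumSerre

/-- The generator `f_{2a+1}`. -/
def gen (a : ℤ) : U := fgen (2 * a + 1)

lemma gen_eq (a : ℤ) : gen a = RingQuot.mkAlgHom K URel (FreeAlgebra.ι K a) := by
  unfold gen fgen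
  congr 2
  omega

lemma gen_commute {a b : ℤ} (h : 1 < |a - b|) : Commute (gen a) (gen b) := by
  have := RingQuot.mkAlgHom_rel K (URel.far a b h)
  simpa only [Commute, SemiconjBy, gen_eq, map_mul] using this

lemma gen_serre {a b : ℤ} (h : |a - b| = 1) : IsSerre q (gen a) (gen b) := by
  have := RingQuot.mkAlgHom_rel K (URel.serre a b h)
  simpa only [IsSerre, gen_eq, map_mul, map_add, map_smul] using this

/-- The segment `⟨2a+1, 2(a+n)+1⟩`. -/
def sg (a : ℤ) (n : ℕ) : U := segAux (2 * a + 1) n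

lemma sg_zero (a : ℤ) : sg a 0 = gen a := rfl

lemma sg_succ (a : ℤ) (n : ℕ) : sg a (n + 1) = qbr q (sg a n) (gen (a + n + 1)) := by
  have : 2 * a + 1 + 2 * ((n : ℤ) + 1) = 2 * (a + n + 1) + 1 := by ring
  simp only [sg, segAux, qbr, gen, this]

lemma commute_sg {y : U} {a : ℤ} {n : ℕ}
    (h : ∀ b, a ≤ b → b ≤ a + n → Commute y (gen b)) : Commute y (sg a n) := by
  induction n with
  | zero => exact h a le_rfl (by simp)
  | succ n ih =>
    rw [sg_succ]
    exact (ih fun b hb hb' => h b hb (by push_cast; omega)).qbr_right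
      (h _ (by omega) (by push_cast; omega))

lemma gen_commute_sg {a c : ℤ} {n : ℕ} (h : c + 1 < a ∨ a + n + 1 < c) :
    Commute (gen c) (sg a n) :=
  commute_sg fun b hb hb' => gen_commute (by rw [lt_abs]; omega)

lemma sg_add (a : ℤ) (m n : ℕ) :
    sg a (m + n + 1) = qbr q (sg a m) (sg (a + m + 1) n) := by
  induction n with
  | zero => exact sg_succ a m
  | succ n ih =>
    rw [← add_assoc, sg_succ, ih, sg_succ (a + m + 1), ← qbr_assoc]
    · congr 2; push_cast; ring
    · exact (gen_commute_sg (by omega)).symm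

lemma sg_succ' (a : ℤ) (n : ℕ) : sg a (n + 1) = qbr q (gen a) (sg (a + 1) n) := by
  simpa [sg_zero] using sg_add a 0 n

lemma q_sq_add_one_ne_zero : q ^ 2 + 1 ≠ 0 := by
  have h : algebraMap (Polynomial ℚ) K (Polynomial.X ^ 2 + 1) ≠ 0 := by
    refine RatFunc.algebraMap_ne_zero ?_
    exact Polynomial.X_pow_add_C_ne_zero (by norm_num) (1 : ℚ)
  simpa [q] using h

lemma gen_serre_sg_left (a : ℤ) (n : ℕ) : IsSerre q (gen a) (sg (a + 1) n) := by
  induction n with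
  | zero => exact gen_serre (by simp)
  | succ n ih =>
    rw [sg_succ]
    exact ih.qbr_right q (gen_commute (by rw [lt_abs]; omega))

lemma gen_serre_sg_right (a : ℤ) (n : ℕ) : IsSerre q (gen (a + n + 1)) (sg a n) := by
  induction n generalizing a with
  | zero => exact gen_serre (by simp)
  | succ n ih =>
    have h := ih (a + 1)
    rw [show a + 1 + (n : ℤ) + 1 = a + (n + 1 : ℕ) + 1 by push_cast; ring] at h
    rw [sg_succ', qbr_inv q_ne_zero]
    exact (h.qbr_right _ (gen_commute (by rw [lt_abs]; push_cast; omega))).smul_right _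

lemma sg_serre_gen_left (a : ℤ) (n : ℕ) : IsSerre q (sg (a + 1) n) (gen a) := by
  induction n generalizing a with
  | zero => exact gen_serre (by simp)
  | succ n ih =>
    rw [sg_succ']
    exact IsSerre.qbr_left q_ne_zero q_sq_add_one_ne_zero (gen_serre (by simp))
      (gen_serre_sg_left _ n) (ih _) (gen_commute_sg (by omega)).symm

lemma sg_serre_gen_right (a : ℤ) (n : ℕ) : IsSerre q (sg a n) (gen (a + n + 1)) := by
  induction n with
  | zero => exact gen_serre (by simp)
  | succ n ih =>
    rw [sg_succ, qbr_inv q_ne_zero]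
    refine IsSerre.smul_left ?_ _
    have hq : q⁻¹ ^ 2 + 1 ≠ 0 := by
      have := q_sq_add_one_ne_zero
      have hq := q_ne_zero
      field_simp
      exact div_ne_zero (by rwa [add_comm]) (pow_ne_zero 2 q_ne_zero)
    have := IsSerre.qbr_left (inv_ne_zero q_ne_zero) hq
      (gen_serre (a := a + n + 1) (b := a + (n + 1 : ℕ) + 1) (by push_cast; ring_nf; simp)).inv
      (gen_serre_sg_right a n).inv ih.inv
      (gen_commute_sg (by push_cast; omega)).symm
    simpa using this.inv

section SymmetricVector

variable {V : Type*} [AddCommGroup V] [Module K V] [Module U V] [IsScalarTower K U V] {φ : V}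

/-- `⟨-(2(a+n)+1), -(2a+1)⟩ φ = ⟨2a+1, 2(a+n)+1⟩ φ`. -/
lemma sg_neg_smul (hφ : ∀ a, gen a • φ = gen (-a - 1) • φ) {a : ℤ} (ha : 0 ≤ a) (n : ℕ) :
    sg (-a - n - 1) n • φ = sg a n • φ := by
  induction n with
  | zero => simpa [sg_zero] using (hφ a).symm
  | succ n ih =>
    have e : -a - ((n + 1 : ℕ) : ℤ) - 1 + 1 = -a - n - 1 := by push_cast; ring
    have hg : gen (-a - (n + 1 : ℕ) - 1) • φ = gen (a + n + 1) • φ := by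
      rw [hφ (a + n + 1)]; congr 2; push_cast; ring
    have c1 : Commute (gen (a + n + 1)) (sg (-a - n - 1) n) := gen_commute_sg (by omega)
    have c2 : Commute (gen (-a - (n + 1 : ℕ) - 1)) (sg a n) :=
      gen_commute_sg (by push_cast; omega)
    rw [sg_succ', e, sg_succ]
    simp only [qbr, sub_smul, smul_assoc, mul_smul]
    rw [ih, ← mul_smul, c2.eq, mul_smul, hg, ← mul_smul (sg (-a - n - 1) n), ← c1.eq, mul_smul, ih]

/-- The symmetric segment `⟨-(2n+1), 2n+1⟩` intertwines `f_{2n+3} + f_{-(2n+3)}` on `φ`. -/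
lemma gen_add_gen_smul_sg (hφ : ∀ a, gen a • φ = gen (-a - 1) • φ) (n : ℕ) :
    gen (n + 1) • sg (-n - 1) (2 * n + 1) • φ + gen (-n - 2) • sg (-n - 1) (2 * n + 1) • φ
      = (q + q⁻¹) • sg (-n - 1) (2 * n + 1) • gen (n + 1) • φ := by
  obtain ⟨A, hA⟩ : ∃ A, A = sg 0 n := ⟨_, rfl⟩
  obtain ⟨B, hB⟩ : ∃ B, B = sg (-n - 1) n := ⟨_, rfl⟩
  obtain ⟨f, hf⟩ : ∃ f, f = gen (n + 1) := ⟨_, rfl⟩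
  obtain ⟨g, hg⟩ : ∃ g, g = gen (-n - 2) := ⟨_, rfl⟩
  have hX : sg (-n - 1) (2 * n + 1) = qbr q B A := by
    have := sg_add (-n - 1) n n
    rw [two_mul, this, hA, hB]
    congr 2
    ring
  have hAB : B • φ = A • φ := by
    have := sg_neg_smul hφ le_rfl n
    rw [hA, hB, ← this]
    simp
  have hfg : g • φ = f • φ := by
    rw [hf, hφ, hg]
    congr 2
    ring
  have fB : f * B = B * f := by
    rw [hf, hB]; exact gen_commute_sg (by omega)
  have gA : g * A = A * g := by
    rw [hg, hA]; exact gen_commute_sg (by omega)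
  have sA : IsSerre q A f := by
    have := sg_serre_gen_right 0 n
    rw [hA, hf]
    simpa using this
  have sB : IsSerre q B g := by
    have := sg_serre_gen_left (-n - 2) n
    rw [hB, hg]
    convert this using 2
    ring
  have tA := congrArg (· • φ) sA
  have tB := congrArg (· • φ) sB
  simp only [add_smul, smul_assoc, mul_smul] at tA tB
  have fB' (v : V) : f • B • v = B • f • v := by rw [← mul_smul, fB, mul_smul]
  have gA' (v : V) : g • A • v = A • g • v := by rw [← mul_smul, gA, mul_smul]
  have fA : f • A • φ = B • f • φ := by rw [← hAB, fB']
  have hq := q_ne_zero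
  rw [hX, ← hf, ← hg]
  simp only [qbr, sub_smul, smul_assoc, mul_smul, smul_sub, smul_comm f q, smul_comm g q,
    fB', gA', hAB, hfg, fA] at tA tB ⊢
  exact add_qcomm_eq hq tA tB

/-- `⟨-(2(a+n+1)+1), 2a+1⟩ φ = q⁻¹ ⟨-(2a+1), 2(a+n+1)+1⟩ φ`. -/
lemma sg_cross_smul (hφ : ∀ a, gen a • φ = gen (-a - 1) • φ) (a n : ℕ) :
    sg (-a - n - 2) (2 * a + n + 2) • φ = (q⁻¹ • sg (-a - 1) (2 * a + n + 2)) • φ := by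
  rw [smul_assoc]
  have hq := q_ne_zero
  induction n with
  | zero =>
    have key := gen_add_gen_smul_sg hφ a
    have hg : gen (-a - 2) • φ = gen (a + 1) • φ := by
      rw [hφ (a + 1)]; congr 2; ring
    have e1 : -(a : ℤ) - 2 + 1 = -a - 1 := by ring
    have e2 : -(a : ℤ) - 1 + (2 * a + 1 : ℕ) + 1 = a + 1 := by push_cast; ring
    simp only [Nat.cast_zero, sub_zero, add_zero]
    rw [sg_succ' _ (2 * a + 1), sg_succ _ (2 * a + 1), e1, e2]
    simp only [qbr, sub_smul, smul_assoc, mul_smul, smul_sub, hg, smul_smul q⁻¹ q,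
      inv_mul_cancel₀ hq, one_smul]
    exact sub_smul_eq_of_add_eq hq key
  | succ n ih =>
    have hg : gen (-a - (n + 1 : ℕ) - 2) • φ = gen (a + n + 2) • φ := by
      rw [hφ (a + n + 2)]; congr 2; push_cast; ring
    have e1 : -(a : ℤ) - (n + 1 : ℕ) - 2 + 1 = -a - n - 2 := by push_cast; ring
    have e2 : -(a : ℤ) - 1 + (2 * a + n + 2 : ℕ) + 1 = a + n + 2 := by push_cast; ring
    have c1 : Commute (gen (a + n + 2)) (sg (-a - n - 2) (2 * a + n + 2)) :=
      gen_commute_sg (by push_cast; omega)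
    have c2 : Commute (gen (-a - (n + 1 : ℕ) - 2)) (sg (-a - 1) (2 * a + n + 2)) :=
      gen_commute_sg (by push_cast; omega)
    rw [show 2 * a + (n + 1) + 2 = 2 * a + n + 2 + 1 by ring, sg_succ', e1,
      sg_succ (-a - 1), e2]
    simp only [qbr, sub_smul, smul_assoc, mul_smul]
    rw [ih, smul_comm _ q⁻¹, ← mul_smul (gen (-a - (n + 1 : ℕ) - 2)), c2.eq, mul_smul, hg,
      ← mul_smul (sg (-a - n - 2) _), ← c1.eq, mul_smul, ih, smul_comm _ q⁻¹, smul_sub,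
      smul_comm q q⁻¹]

end SymmetricVector

lemma seg_smul_of_symm {V : Type*} [AddCommGroup V] [Module U V] {φ : V}
    (hφ : ∀ a, gen a • φ = gen (-a - 1) • φ) :
    (∀ i j : ℤ, Odd i → Odd j → 1 ≤ i → i ≤ j →
      seg (-j) (-i) • φ = seg i j • φ) ∧
    (∀ i j : ℤ, Odd i → Odd j → 1 ≤ i → i < j →
      seg (-j) i • φ = (q⁻¹ • seg (-i) j) • φ) := by
  let : Module K V := Module.compHom V (algebraMap K U)
  have : IsScalarTower K U V := ⟨fun c u v => by rw [Algebra.smul_def, mul_smul]; rfl⟩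
  constructor
  · rintro i j ⟨a, rfl⟩ ⟨b, rfl⟩ hi hij
    obtain ⟨n, rfl⟩ : ∃ n : ℕ, b = a + n := ⟨(b - a).toNat, by omega⟩
    have h := sg_neg_smul hφ (a := a) (by omega) n
    simp only [sg] at h
    unfold seg
    convert h using 3 <;> omega
  · rintro i j ⟨a, rfl⟩ ⟨b, rfl⟩ hi hij
    obtain ⟨n, rfl⟩ : ∃ n : ℕ, b = a + n + 1 := ⟨(b - a - 1).toNat, by omega⟩
    obtain ⟨a, rfl⟩ : ∃ m : ℕ, a = m := ⟨a.toNat, by omega⟩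
    have h := sg_cross_smul hφ a n
    simp only [sg] at h
    unfold seg
    convert h using 3
    · ring
    · omega
    · congr 1 <;> omega

lemma gen_smul_phi (a : ℤ) : gen a • phi = gen (-a - 1) • phi := by
  have h : gen a - gen (-a - 1) ∈ Jideal := by
    refine Ideal.subset_span ⟨2 * a + 1, odd_two_mul_add_one a, ?_⟩
    simp only [gen]
    congr 2
    ring
  have h' : (Submodule.Quotient.mk (gen a) : Vt) = Submodule.Quotient.mk (gen (-a - 1)) :=
    (Submodule.Quotient.eq Jideal).2 h
  simpa only [phi, ← Submodule.Quotient.mk_smul, smul_eq_mul, mul_one] using h'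

/-- Lemma 3.16 of Enomoto–Kashiwara: (i) for odd `1 ≤ i ≤ j`, `⟨−j,−i⟩φ̃ = ⟨i,j⟩φ̃`;
(ii) for odd `1 ≤ i < j`, `⟨−j,i⟩φ̃ = q⁻¹⟨−i,j⟩φ̃`. -/
theorem segment_phi_relations :
    (∀ i j : ℤ, Odd i → Odd j → 1 ≤ i → i ≤ j →
      seg (-j) (-i) • phi = seg i j • phi) ∧
    (∀ i j : ℤ, Odd i → Odd j → 1 ≤ i → i < j →
      seg (-j) i • phi = (q⁻¹ • seg (-i) j) • phi) :=
  seg_smul_of_symm gen_smul_phi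

end
end
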